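/- arXiv:1102.4589 — 2 statements merged into one kernel-verified Lean document; each statement's English description precedes it below -/
import Mathlib

section
/- Let g ≥ 1 and m ≥ 1 be integers. Then there exists a subgroup K of N(g,m) of index 4 such that for every i ∈ {1,…,m} and every x ∈ N(g,m) one has x·p_i·x⁻¹ ∉ K and x·p_i²·x⁻¹ ∈ K. (Equivalently, for each i the right multiplication action of ⟨p_i⟩ on the 4-element coset space K\N(g,m) has exactly two orbits, each of size 2.) This is the non-orientable case of the paper's Lemma on 4-sheeted covers: a compact non-orientable surface with m ≥ 1 boundary circles (not the projective plane, which has no boundary) admits a 4-sheeted cover in which every boundary circle is covered by exactly two boundary circles, each double-covering it. -/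
/-- Generators of the fundamental group of a compact non-orientable surface of genus `g`
with `m` boundary components: `a j` for `j : Fin g` and `p i` for `i : Fin m`. -/
abbrev NonorientableGen (g m : ℕ) : Type := Fin g ⊕ Fin m

/-- The single relator `p 1 ⋯ p m · (a 1)² ⋯ (a g)²`. -/
def nonorientableRelator (g m : ℕ) : FreeGroup (NonorientableGen g m) :=
  (List.ofFn (fun i : Fin m => FreeGroup.of (Sum.inr i : NonorientableGen g m))).prod *
  (List.ofFn (fun j : Fin g =>
      (FreeGroup.of (Sum.inl j : NonorientableGen g m)) ^ 2)).prod

/-- `N(g,m)`, the fundamental group of a compact non-orientable surface of genus `g`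
with `m` boundary components. -/
def NonorientableSurfaceGroup (g m : ℕ) : Type :=
  PresentedGroup ({nonorientableRelator g m} : Set (FreeGroup (NonorientableGen g m)))

instance (g m : ℕ) : Group (NonorientableSurfaceGroup g m) :=
  inferInstanceAs (Group (PresentedGroup _))

/-- The boundary classes `p i` of `N(g,m)`. -/
def nBoundaryClass (g m : ℕ) (i : Fin m) : NonorientableSurfaceGroup g m :=
  PresentedGroup.of (Sum.inr i)

/-- In a commutative group `A`, elements `u` and `v` with `u ^ m * v ^ 2 = 1` define a
homomorphism from `N(g + 1, m)` sending every boundary class to `u` and the first crosscap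
generator to `v`. -/
theorem exists_hom_of_boundary_crosscap {A : Type*} [CommGroup A] (g m : ℕ) (u v : A)
    (h : u ^ m * v ^ 2 = 1) :
    ∃ f : NonorientableSurfaceGroup (g + 1) m →* A,
      (∀ i, f (nBoundaryClass (g + 1) m i) = u) ∧ ∃ y, f y = v := by
  let F : NonorientableGen (g + 1) m → A :=
    Sum.elim (fun j => if j = 0 then v else 1) (fun _ => u)
  have hF : ∀ r ∈ ({nonorientableRelator (g + 1) m} : Set (FreeGroup _)),
      FreeGroup.lift F r = 1 := by
    rintro r rfl
    simpa [nonorientableRelator, F, map_list_prod, List.prod_ofFn, Fin.prod_univ_succ,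
      Fin.succ_ne_zero] using h
  exact ⟨PresentedGroup.toGroup hF, fun _ => PresentedGroup.toGroup.of hF,
    PresentedGroup.of (Sum.inl 0), PresentedGroup.toGroup.of hF⟩

/-- A surjection from a group onto a commutative group of order `n` that sends every `p i` to
an element `u` of order two has a kernel of index `n` that avoids all conjugates of the `p i`
and contains all conjugates of their squares. -/
theorem exists_index_eq_card_of_surjective {G A ι : Type*} [Group G] [CommGroup A]
    (f : G →* A) (hf : Function.Surjective f) (p : ι → G) (u : A) (hu : u ≠ 1)
    (hu2 : u ^ 2 = 1) (hp : ∀ i, f (p i) = u) :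
    ∃ K : Subgroup G, K.index = Nat.card A ∧
      ∀ i x, x * p i * x⁻¹ ∉ K ∧ x * p i ^ 2 * x⁻¹ ∈ K := by
  refine ⟨f.ker, ?_, fun i x => ?_⟩
  · rw [Subgroup.index_ker, MonoidHom.range_eq_top.mpr hf]
    exact Subgroup.card_top
  · simp [MonoidHom.mem_ker, hp, hu, hu2]

/-- A compact non-orientable surface of genus `g ≥ 1` with `m ≥ 1` boundary circles
admits a 4-sheeted cover in which every boundary circle is covered by exactly two
boundary circles, each double-covering it: there is a subgroup `K` of index `4` in
`N(g,m)` such that for every boundary class `p i` and every `x`,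
`x * p i * x⁻¹ ∉ K` and `x * (p i)^2 * x⁻¹ ∈ K`. -/
theorem four_sheeted_cover_nonorientable (g m : ℕ) (hg : 1 ≤ g) (hm : 1 ≤ m) :
    ∃ K : Subgroup (NonorientableSurfaceGroup g m), K.index = 4 ∧
      ∀ (i : Fin m) (x : NonorientableSurfaceGroup g m),
        x * nBoundaryClass g m i * x⁻¹ ∉ K ∧
        x * (nBoundaryClass g m i) ^ 2 * x⁻¹ ∈ K := by
  obtain ⟨g, rfl⟩ := Nat.exists_eq_add_of_le' hg
  rcases Nat.even_or_odd' m with ⟨k, rfl | rfl⟩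
  · let u : Multiplicative (ZMod 2 × ZMod 2) := .ofAdd (1, 0)
    let v : Multiplicative (ZMod 2 × ZMod 2) := .ofAdd (0, 1)
    have hu2 : u ^ 2 = 1 := by decide
    have hv2 : v ^ 2 = 1 := by decide
    obtain ⟨f, hf, y, hy⟩ := exists_hom_of_boundary_crosscap g (2 * k) u v
      (by rw [pow_mul, hu2, hv2, one_pow, one_mul])
    have hsurj : Function.Surjective f := by
      intro z
      have hz : ∃ a b : Fin 2, u ^ (a : ℕ) * v ^ (b : ℕ) = z := by
        revert z; decide
      obtain ⟨a, b, hab⟩ := hz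
      exact ⟨nBoundaryClass (g + 1) (2 * k) ⟨0, hm⟩ ^ (a : ℕ) * y ^ (b : ℕ), by
        rw [map_mul, map_pow, map_pow, hf, hy, hab]⟩
    have hcard : Nat.card (Multiplicative (ZMod 2 × ZMod 2)) = 4 := by simp
    rw [← hcard]
    exact exists_index_eq_card_of_surjective f hsurj _ u (by decide) hu2 hf
  · let u : Multiplicative (ZMod 4) := .ofAdd 2
    let v : Multiplicative (ZMod 4) := .ofAdd 1
    have hu2 : u ^ 2 = 1 := by decide
    have huv : u * v ^ 2 = 1 := by decide
    obtain ⟨f, hf, y, hy⟩ := exists_hom_of_boundary_crosscap g (2 * k + 1) u v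
      (by rw [pow_succ, pow_mul, hu2, one_pow, one_mul, huv])
    have hsurj : Function.Surjective f := by
      intro z
      have hz : ∃ a : Fin 4, v ^ (a : ℕ) = z := by
        revert z; decide
      obtain ⟨a, ha⟩ := hz
      exact ⟨y ^ (a : ℕ), by rw [map_pow, hy, ha]⟩
    have hcard : Nat.card (Multiplicative (ZMod 4)) = 4 := by simp
    rw [← hcard]
    exact exists_index_eq_card_of_surjective f hsurj _ u (by decide) hu2 hf
end

section
/- The presented group ⟨x, y | x² = y²⟩ (one relator x²y⁻²) is isomorphic to the semidirect product ℤ ⋊ ℤ in which the generator of the acting copy of ℤ acts on the normal copy of ℤ by negation; equivalently, it is isomorphic to the Klein bottle group ⟨a, b | b·a·b⁻¹ = a⁻¹⟩. (An isomorphism is induced by a ↦ x·y⁻¹, b ↦ y.) -/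
/-- The relator `x² y⁻²` on two generators (`true ↦ x`, `false ↦ y`). -/
def kleinRelator : FreeGroup Bool :=
  (FreeGroup.of true) ^ 2 * ((FreeGroup.of false) ^ 2)⁻¹

/-- The presented group `⟨x, y | x² = y²⟩`. -/
def KleinPresented : Type :=
  PresentedGroup ({kleinRelator} : Set (FreeGroup Bool))

instance : Group KleinPresented := inferInstanceAs (Group (PresentedGroup _))

/-- The action `φ : ℤ → Aut ℤ` sending the generator `1` of `ℤ` to negation
(written multiplicatively: inversion). -/
def negAction : Multiplicative ℤ →* MulAut (Multiplicative ℤ) :=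
  zpowersHom (MulAut (Multiplicative ℤ)) (MulEquiv.inv (Multiplicative ℤ))

/-- Equivariance with respect to an action of `ℤ` only needs to be checked on the generator. -/
theorem map_int_action_eq_conj {N G : Type*} [Group N] [Group G]
    (φ : Multiplicative ℤ →* MulAut N) (f₁ : N →* G) (f₂ : Multiplicative ℤ →* G)
    (h : ∀ n, f₁ (φ (Multiplicative.ofAdd 1) n) =
      f₂ (Multiplicative.ofAdd 1) * f₁ n * (f₂ (Multiplicative.ofAdd 1))⁻¹)
    (g : Multiplicative ℤ) :
    f₁.comp (φ g).toMonoidHom = (MulAut.conj (f₂ g)).toMonoidHom.comp f₁ := by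
  have key : ∀ k : ℤ, ∀ n, f₁ (φ (Multiplicative.ofAdd k) n) =
      f₂ (Multiplicative.ofAdd k) * f₁ n * (f₂ (Multiplicative.ofAdd k))⁻¹ := by
    intro k
    induction k using Int.induction_on with
    | zero => simp
    | succ i ih =>
      intro n
      rw [ofAdd_add, map_mul, map_mul, MulAut.mul_apply, ih, h]
      group
    | pred i ih =>
      intro n
      have hn := h ((φ (Multiplicative.ofAdd 1))⁻¹ n)
      rw [MulAut.apply_inv_self] at hn
      rw [ofAdd_sub, div_eq_mul_inv, map_mul, map_mul, MulAut.mul_apply, ih, map_inv, map_inv, hn]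
      group
  ext n
  exact key g.toAdd n

theorem negAction_ofAdd_one (n : Multiplicative ℤ) :
    negAction (Multiplicative.ofAdd 1) n = n⁻¹ := by
  simp [negAction]

namespace KleinPresented

/-- The generator `x` (for `true`) or `y` (for `false`) of `⟨x, y | x² = y²⟩`. -/
def gen (i : Bool) : KleinPresented :=
  PresentedGroup.of i

theorem gen_true_sq : gen true ^ 2 = gen false ^ 2 :=
  mul_inv_eq_one.mp
    (PresentedGroup.one_of_mem (rels := {kleinRelator}) (Set.mem_singleton kleinRelator))

theorem hom_ext {G : Type*} [Group G] {f g : KleinPresented →* G}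
    (h : ∀ i, f (gen i) = g (gen i)) : f = g :=
  PresentedGroup.ext (rels := {kleinRelator}) h

/-- The homomorphism out of `⟨x, y | x² = y²⟩` determined by two elements with equal squares. -/
def lift {G : Type*} [Group G] (f : Bool → G) (h : f true ^ 2 = f false ^ 2) :
    KleinPresented →* G :=
  PresentedGroup.toGroup (rels := {kleinRelator}) (f := f) (by
    rintro _ rfl
    simp [kleinRelator, h])

@[simp]
theorem lift_gen {G : Type*} [Group G] (f : Bool → G) (h : f true ^ 2 = f false ^ 2) (i : Bool) :
    lift f h (gen i) = f i :=
  PresentedGroup.toGroup.of _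

theorem conj_gen_mul_inv :
    gen false * (gen true * (gen false)⁻¹) * (gen false)⁻¹ = (gen true * (gen false)⁻¹)⁻¹ := by
  calc gen false * (gen true * (gen false)⁻¹) * (gen false)⁻¹
      = gen false * gen true * (gen false ^ 2)⁻¹ := by group
    _ = gen false * gen true * (gen true ^ 2)⁻¹ := by rw [gen_true_sq]
    _ = (gen true * (gen false)⁻¹)⁻¹ := by group

/-- The homomorphism from `⟨x, y | x² = y²⟩` to `ℤ ⋊ ℤ` given by `x ↦ ab`, `y ↦ b`. -/
def toSemidirect : KleinPresented →* Multiplicative ℤ ⋊[negAction] Multiplicative ℤ :=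
  lift (fun i => ⟨if i then Multiplicative.ofAdd 1 else 1, Multiplicative.ofAdd 1⟩) (by
    ext <;> simp [pow_two, negAction_ofAdd_one])

/-- The homomorphism from `ℤ ⋊ ℤ` to `⟨x, y | x² = y²⟩` given by `a ↦ xy⁻¹`, `b ↦ y`. -/
def ofSemidirect : Multiplicative ℤ ⋊[negAction] Multiplicative ℤ →* KleinPresented :=
  SemidirectProduct.lift (zpowersHom _ (gen true * (gen false)⁻¹)) (zpowersHom _ (gen false))
    (map_int_action_eq_conj _ _ _ fun n => by
      rw [negAction_ofAdd_one, map_inv, zpowersHom_apply, zpowersHom_apply, toAdd_ofAdd, zpow_one,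
        ← conj_zpow, conj_gen_mul_inv, inv_zpow])

theorem ofSemidirect_comp_toSemidirect :
    ofSemidirect.comp toSemidirect = MonoidHom.id KleinPresented :=
  hom_ext fun i => by
    cases i <;> simp [ofSemidirect, toSemidirect, SemidirectProduct.lift]

theorem toSemidirect_comp_ofSemidirect :
    toSemidirect.comp ofSemidirect = MonoidHom.id _ := by
  refine SemidirectProduct.hom_ext (MonoidHom.ext_mint ?_) (MonoidHom.ext_mint ?_)
  · ext <;> simp [ofSemidirect, toSemidirect]
  · ext <;> simp [ofSemidirect, toSemidirect]

end KleinPresented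

/-- The presented group `⟨x, y | x² = y²⟩` is isomorphic to the semidirect product
`ℤ ⋊ ℤ` in which the generator of the acting copy of `ℤ` acts on the normal copy by
negation (the Klein bottle group). -/
theorem presented_iso_klein :
    Nonempty (KleinPresented ≃* (Multiplicative ℤ ⋊[negAction] Multiplicative ℤ)) := by
  exact ⟨MonoidHom.toMulEquiv KleinPresented.toSemidirect KleinPresented.ofSemidirect
    KleinPresented.ofSemidirect_comp_toSemidirect KleinPresented.toSemidirect_comp_ofSemidirect⟩
end
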